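/- Let D be a digraph and R₁, …, R_k nonempty subsets of V(D). There exist k pairwise arc-disjoint branchings B₁, …, B_k in D with root sets R(B_i) = R_i for every i if and only if for every nonempty X ⊆ V(D): d⁻_D(X) ≥ |{ i ∈ [k] : R_i ∩ X = ∅ }|. -/

import Mathlib

open Finset

section BranchSetup

variable {V A : Type} [Fintype V] [DecidableEq V] [Fintype A] [DecidableEq A]

/-- One arc-step within the arc set `B` of the digraph `D = (V, A)`. -/
def DStep (tl hd : A → V) (B : Finset A) (u v : V) : Prop :=
  ∃ a ∈ B, tl a = u ∧ hd a = v

/-- `B` is a branching: every vertex has in-degree at most one in `B` and `B`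
contains no (directed) cycle; equivalently each component of the spanning
subdigraph `(V, B)` is an arborescence. -/
def IsBranching (tl hd : A → V) (B : Finset A) : Prop :=
  (∀ a ∈ B, ∀ b ∈ B, hd a = hd b → a = b) ∧
  (∀ v : V, ¬ Relation.TransGen (DStep tl hd B) v v)

/-- The root set `R(B)` of a branching: the vertices of in-degree zero, i.e.
the roots of the arborescence components. -/
def roots (hd : A → V) (B : Finset A) : Finset V :=
  Finset.univ.filter fun v => ∀ a ∈ B, hd a ≠ v

/-- `d⁻_{A₀}(X)`: the number of arcs of `A₀` with head in `X` and tail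
outside of `X`. -/
def dInD (tl hd : A → V) (A₀ : Finset A) (X : Finset V) : ℕ :=
  (A₀.filter fun a => hd a ∈ X ∧ tl a ∉ X).card

end BranchSetup

section BranchLemmas

variable {V A ι : Type} [DecidableEq V]

theorem dInD_submodular (tl hd : A → V) (S : Finset A) (X Y : Finset V) :
    dInD tl hd S (X ∩ Y) + dInD tl hd S (X ∪ Y) ≤ dInD tl hd S X + dInD tl hd S Y := by
  simp only [dInD, Finset.card_filter, ← Finset.sum_add_distrib]
  refine Finset.sum_le_sum fun a _ => ?_
  simp only [Finset.mem_inter, Finset.mem_union]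
  by_cases h₁ : hd a ∈ X <;> by_cases h₂ : hd a ∈ Y <;> by_cases h₃ : tl a ∈ X <;>
    by_cases h₄ : tl a ∈ Y <;> simp [h₁, h₂, h₃, h₄]

variable [Fintype V]

theorem ite_avoid_supermodular (S X Y : Finset V) :
    ((if ∀ v ∈ X, v ∉ S then 1 else 0) + if ∀ v ∈ Y, v ∉ S then 1 else 0 : ℕ) ≤
      (if ∀ v ∈ X ∩ Y, v ∉ S then 1 else 0) + if ∀ v ∈ X ∪ Y, v ∉ S then 1 else 0 := by
  by_cases hX : ∀ v ∈ X, v ∉ S <;> by_cases hY : ∀ v ∈ Y, v ∉ S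
  · rw [if_pos hX, if_pos hY, if_pos (by grind), if_pos (by grind)]
  · rw [if_pos hX, if_neg hY, if_pos (by grind)]; omega
  · rw [if_neg hX, if_pos hY, if_pos (by grind)]; omega
  · rw [if_neg hX, if_neg hY]; omega

variable [Fintype ι]

/-- The number of members of the family `R` that are disjoint from `X`. -/
def avoidCount (R : ι → Finset V) (X : Finset V) : ℕ :=
  (Finset.univ.filter fun i : ι => ∀ v ∈ X, v ∉ R i).card

theorem avoidCount_supermodular (R : ι → Finset V) (X Y : Finset V) :
    avoidCount R X + avoidCount R Y ≤ avoidCount R (X ∩ Y) + avoidCount R (X ∪ Y) := by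
  simp only [avoidCount, Finset.card_filter, ← Finset.sum_add_distrib]
  exact Finset.sum_le_sum fun i _ => ite_avoid_supermodular (R i) X Y

theorem avoidCount_supermodular_strict (R : ι → Finset V) (X Y : Finset V) (i : ι)
    (hX : ∃ v ∈ X, v ∈ R i) (hY : ∃ v ∈ Y, v ∈ R i) (hXY : ∀ v ∈ X ∩ Y, v ∉ R i) :
    avoidCount R X + avoidCount R Y < avoidCount R (X ∩ Y) + avoidCount R (X ∪ Y) := by
  simp only [avoidCount, Finset.card_filter, ← Finset.sum_add_distrib]
  refine Finset.sum_lt_sum (fun i _ => ite_avoid_supermodular (R i) X Y) ⟨i, mem_univ i, ?_⟩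
  rw [if_neg (by grind), if_neg (by grind), if_pos hXY]
  omega

/-- In a tight set that is minimal among those meeting both `R i` and its complement, some arc
leads from `R i` to its complement. -/
theorem exists_arc_of_tight (tl hd : A → V) (S : Finset A) (R : ι → Finset V) (i : ι)
    (W : Finset V)
    (h : avoidCount R (W \ R i) ≤ dInD tl hd S (W \ R i))
    (hW : dInD tl hd S W = avoidCount R W) (hmeet : ∃ v ∈ W, v ∈ R i) :
    ∃ a ∈ S, tl a ∈ W ∧ tl a ∈ R i ∧ hd a ∈ W ∧ hd a ∉ R i := by
  have hlt : avoidCount R W < avoidCount R (W \ R i) := by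
    refine Finset.card_lt_card ((Finset.ssubset_iff_of_subset ?_).2 ⟨i, ?_, ?_⟩)
    · intro j; simp only [mem_filter, mem_univ, true_and, mem_sdiff]; grind
    · simp
    · simpa using hmeet
  by_contra! hno
  have hle : dInD tl hd S (W \ R i) ≤ dInD tl hd S W := by
    refine Finset.card_le_card fun a => ?_
    simp only [mem_filter, mem_sdiff]
    grind
  omega

variable [DecidableEq A]

/-- An arc can be moved into the `i`-th branching without violating the cut condition. -/
theorem exists_admissible_arc [DecidableEq ι] (tl hd : A → V) (S : Finset A) (R : ι → Finset V) (i : ι)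
    (hR : (R i).Nonempty) (hi : R i ≠ Finset.univ)
    (h : ∀ X : Finset V, X.Nonempty → avoidCount R X ≤ dInD tl hd S X) :
    ∃ a ∈ S, tl a ∈ R i ∧ hd a ∉ R i ∧ ∀ X : Finset V, X.Nonempty →
      avoidCount (Function.update R i (insert (hd a) (R i))) X ≤ dInD tl hd (S.erase a) X := by
  obtain ⟨w, hw⟩ : ∃ w, w ∉ R i := by
    by_contra! hall
    exact hi (Finset.eq_univ_of_forall hall)
  obtain ⟨r, hr⟩ := hR
  let T := Finset.univ.filter fun W : Finset V =>
    (∃ v ∈ W, v ∈ R i) ∧ (∃ v ∈ W, v ∉ R i) ∧ dInD tl hd S W = avoidCount R W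
  have huniv : Finset.univ ∈ T := by
    simp only [T, mem_filter, mem_univ, true_and]
    refine ⟨⟨r, hr⟩, ⟨w, hw⟩, ?_⟩
    have := h Finset.univ ⟨w, mem_univ w⟩
    have : dInD tl hd S Finset.univ = 0 := by simp [dInD]
    omega
  obtain ⟨W, hWT, hmin⟩ := Finset.exists_min_image T Finset.card ⟨_, huniv⟩
  simp only [T, mem_filter, mem_univ, true_and] at hWT hmin
  obtain ⟨hmeet, ⟨x, hxW, hx⟩, hW⟩ := hWT
  obtain ⟨a, haS, htW, htR, hhW, hhR⟩ := exists_arc_of_tight tl hd S R i W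
    (h _ ⟨x, by simp [hxW, hx]⟩) hW hmeet
  refine ⟨a, haS, htR, hhR, fun X hX => ?_⟩
  have hg : avoidCount (Function.update R i (insert (hd a) (R i))) X ≤ avoidCount R X := by
    refine Finset.card_le_card fun j => ?_
    simp only [mem_filter, mem_univ, true_and]
    rcases eq_or_ne j i with rfl | hj
    · simp only [Function.update_self]; grind
    · simp [Function.update_of_ne hj]
  have herase : dInD tl hd (S.erase a) X =
      ((S.filter fun b => hd b ∈ X ∧ tl b ∉ X).erase a).card := by
    rw [dInD, Finset.filter_erase]
  have hXle := h X hX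
  by_cases hent : hd a ∈ X ∧ tl a ∉ X
  · have hd1 : dInD tl hd (S.erase a) X + 1 = dInD tl hd S X := by
      rw [herase]
      exact Finset.card_erase_add_one (by simp [haS, hent])
    by_contra! hcon
    have hXtight : dInD tl hd S X = avoidCount R X := by omega
    have hXmeet : ∃ v ∈ X, v ∈ R i := by
      by_contra! hno
      have : avoidCount (Function.update R i (insert (hd a) (R i))) X < avoidCount R X := by
        refine Finset.card_lt_card ((Finset.ssubset_iff_of_subset ?_).2 ⟨i, ?_, ?_⟩)
        · intro j
          simp only [mem_filter, mem_univ, true_and]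
          rcases eq_or_ne j i with rfl | hj
          · simp only [Function.update_self]; grind
          · simp [Function.update_of_ne hj]
        · simpa using hno
        · simp only [mem_filter, mem_univ, true_and, Function.update_self]
          exact fun hc => hc _ hent.1 (Finset.mem_insert_self _ _)
      omega
    have hsub := dInD_submodular tl hd S X W
    have hinter := h (X ∩ W) ⟨hd a, by simp [hent, hhW]⟩
    have hunion := h (X ∪ W) ⟨hd a, by simp [hhW]⟩
    by_cases hXW : ∀ v ∈ X ∩ W, v ∉ R i
    · have := avoidCount_supermodular_strict R X W i hXmeet hmeet hXW
      omega
    · have hsup := avoidCount_supermodular R X W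
      push Not at hXW
      have hcard := hmin (X ∩ W) ⟨hXW, ⟨hd a, by simp [hent, hhW], hhR⟩, by omega⟩
      have heq := Finset.eq_of_subset_of_card_le Finset.inter_subset_right hcard
      have : tl a ∈ X ∩ W := heq.ge htW
      exact hent.2 (Finset.mem_inter.1 this).1
  · have : dInD tl hd (S.erase a) X = dInD tl hd S X := by
      rw [herase, Finset.erase_eq_of_notMem (by simp only [mem_filter]; tauto)]
      rfl
    omega

variable [Fintype A]

/-- Adding an arc between two distinct roots of a branching yields a branching. -/
theorem IsBranching.insert_arc {tl hd : A → V} {B : Finset A} (hB : IsBranching tl hd B) (a : A)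
    (hne : tl a ≠ hd a) (ht : tl a ∈ roots hd B) (hh : hd a ∈ roots hd B) :
    IsBranching tl hd (insert a B) := by
  simp only [roots, mem_filter, mem_univ, true_and] at ht hh
  refine ⟨?_, ?_⟩
  · intro b hb c hc hbc
    rcases Finset.mem_insert.1 hb with hba | hb' <;>
      rcases Finset.mem_insert.1 hc with hca | hc'
    · rw [hba, hca]
    · exact absurd (hbc.symm.trans (congrArg hd hba)) (hh c hc')
    · exact absurd (hbc.trans (congrArg hd hca)) (hh b hb')
    · exact hB.1 b hb' c hc' hbc
  · have hin : ∀ x, ¬ Relation.TransGen (DStep tl hd (insert a B)) x (tl a) := by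
      intro x hx
      obtain ⟨y, -, b, hb, -, hbt⟩ := Relation.TransGen.tail'_iff.1 hx
      rcases Finset.mem_insert.1 hb with rfl | hb
      · exact hne hbt.symm
      · exact ht b hb hbt
    have key : ∀ x y, x ≠ tl a → Relation.TransGen (DStep tl hd (insert a B)) x y →
        Relation.TransGen (DStep tl hd B) x y := by
      intro x y hx hxy
      induction hxy with
      | single hs =>
        obtain ⟨b, hb, hbt, hbh⟩ := hs
        rcases Finset.mem_insert.1 hb with rfl | hb
        · exact absurd hbt.symm hx
        · exact .single ⟨b, hb, hbt, hbh⟩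
      | tail hxz hs ih =>
        obtain ⟨b, hb, hbt, hbh⟩ := hs
        rcases Finset.mem_insert.1 hb with rfl | hb
        · exact absurd (hbt ▸ hxz) (hin x)
        · exact ih.tail ⟨b, hb, hbt, hbh⟩
    intro v hv
    have hvt : v ≠ tl a := by
      rintro rfl
      exact hin _ hv
    exact hB.2 v (key v v hvt hv)

theorem roots_insert (hd : A → V) (B : Finset A) (a : A) :
    roots hd (insert a B) = (roots hd B).erase (hd a) := by
  ext v
  simp only [roots, mem_filter, mem_univ, true_and, Finset.forall_mem_insert, mem_erase]
  grind

/-- The cut condition with respect to an arc set `S` yields disjoint branchings inside `S`. -/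
theorem exists_branchings_of_cut [DecidableEq ι] (tl hd : A → V) (hloop : ∀ a, tl a ≠ hd a) (n : ℕ) :
    ∀ (S : Finset A) (R : ι → Finset V), (∀ i, (R i).Nonempty) → ∑ i, (R i)ᶜ.card = n →
      (∀ X : Finset V, X.Nonempty → avoidCount R X ≤ dInD tl hd S X) →
      ∃ B : ι → Finset A, (∀ i, B i ⊆ S) ∧ (∀ i, IsBranching tl hd (B i)) ∧
        (∀ i j, i ≠ j → Disjoint (B i) (B j)) ∧ ∀ i, roots hd (B i) = R i := by
  induction n using Nat.strong_induction_on with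
  | _ n ih =>
    intro S R hR hn h
    by_cases hall : ∀ i, R i = Finset.univ
    · refine ⟨fun _ => ∅, by simp, fun _ => ⟨by simp, fun v hv => ?_⟩, by simp,
        fun i => by simp [roots, hall i]⟩
      obtain ⟨y, -, b, hb, -⟩ := Relation.TransGen.tail'_iff.1 hv
      simp at hb
    push Not at hall
    obtain ⟨i, hi⟩ := hall
    obtain ⟨a, haS, htR, hhR, hcut⟩ := exists_admissible_arc tl hd S R i (hR i) hi h
    obtain ⟨B, hBS, hB, hdisj, hroots⟩ := ih _ (hn ▸ Finset.sum_lt_sum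
      (f := fun j => (Function.update R i (insert (hd a) (R i)) j)ᶜ.card)
      (g := fun j => (R j)ᶜ.card) (fun j _ => by
        refine Finset.card_le_card (Finset.compl_subset_compl.2 ?_)
        rcases eq_or_ne j i with rfl | hj
        · simp
        · simp [Function.update_of_ne hj])
      ⟨i, mem_univ i, by
        refine Finset.card_lt_card (Finset.compl_ssubset_compl.2 ?_)
        simpa using Finset.ssubset_insert hhR⟩)
      (S.erase a) (Function.update R i (insert (hd a) (R i))) (fun j => by
        rcases eq_or_ne j i with rfl | hj
        · simp
        · simpa [Function.update_of_ne hj] using hR j) rfl hcut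
    have ha : ∀ j, a ∉ B j := fun j haj => by simpa using hBS j haj
    have hri := hroots i
    rw [Function.update_self] at hri
    refine ⟨Function.update B i (insert a (B i)), fun j => ?_, fun j => ?_, fun j l hjl => ?_,
      fun j => ?_⟩
    · rcases eq_or_ne j i with rfl | hj
      · rw [Function.update_self]
        exact Finset.insert_subset haS ((hBS j).trans (Finset.erase_subset _ _))
      · rw [Function.update_of_ne hj]
        exact (hBS j).trans (Finset.erase_subset _ _)
    · rcases eq_or_ne j i with rfl | hj
      · rw [Function.update_self]
        exact (hB j).insert_arc a (hloop a) (by simp [hri, htR]) (by simp [hri])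
      · rw [Function.update_of_ne hj]
        exact hB j
    · rcases eq_or_ne j i with rfl | hj
      · rw [Function.update_self, Function.update_of_ne hjl.symm]
        exact Finset.disjoint_insert_left.2 ⟨ha l, hdisj j l hjl⟩
      · rw [Function.update_of_ne hj]
        rcases eq_or_ne l i with rfl | hl
        · rw [Function.update_self]
          exact Finset.disjoint_insert_right.2 ⟨ha j, hdisj j l hjl⟩
        · rw [Function.update_of_ne hl]
          exact hdisj j l hjl
    · rcases eq_or_ne j i with rfl | hj
      · rw [Function.update_self, roots_insert, hri, Finset.erase_insert hhR]
      · rw [Function.update_of_ne hj, hroots, Function.update_of_ne hj]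

/-- A branching enters every nonempty vertex set that contains none of its roots. -/
theorem IsBranching.exists_entering_arc {tl hd : A → V} {B : Finset A}
    (hB : IsBranching tl hd B) {X : Finset V} (hX : X.Nonempty)
    (hroots : ∀ v ∈ X, v ∉ roots hd B) : ∃ a ∈ B, hd a ∈ X ∧ tl a ∉ X := by
  have : Std.Irrefl (Relation.TransGen (DStep tl hd B)) := ⟨hB.2⟩
  have hwf : WellFounded (Relation.TransGen (DStep tl hd B)) :=
    Finite.wellFounded_of_trans_of_irrefl _
  obtain ⟨m, hm, hmin⟩ := hwf.has_min (X : Set V) hX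
  have hroot := hroots m hm
  simp only [roots, mem_filter, mem_univ, true_and] at hroot
  push Not at hroot
  obtain ⟨a, ha, rfl⟩ := hroot
  exact ⟨a, ha, hm, fun hta => hmin (tl a) hta (.single ⟨a, ha, rfl, rfl⟩)⟩

/-- Disjoint branchings force the cut condition. -/
theorem avoidCount_le_dInD (tl hd : A → V) (R : ι → Finset V) (B : ι → Finset A)
    (hB : ∀ i, IsBranching tl hd (B i)) (hdisj : ∀ i j, i ≠ j → Disjoint (B i) (B j))
    (hroots : ∀ i, roots hd (B i) = R i) (X : Finset V) (hX : X.Nonempty) :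
    avoidCount R X ≤ dInD tl hd Finset.univ X := by
  have hex : ∀ i, (∀ v ∈ X, v ∉ R i) → ∃ a ∈ B i, hd a ∈ X ∧ tl a ∉ X := fun i hi =>
    (hB i).exists_entering_arc hX (by rwa [hroots i])
  refine Finset.card_le_card_of_forall_subsingleton (fun i a => a ∈ B i) (fun i hi => ?_)
    fun a _ i hi j hj => ?_
  · obtain ⟨a, ha, haX⟩ := hex i (by simpa using hi)
    exact ⟨a, by simpa using haX, ha⟩
  · by_contra hne
    exact Finset.disjoint_left.1 (hdisj i j hne) hi.2 hj.2

end BranchLemmas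

/-- **Theorem (Edmonds' branching theorem).**  There exist `k` arc-disjoint
branchings `B₁, …, B_k` in `D` with root sets `R(Bᵢ) = Rᵢ` iff for every
nonempty `X ⊆ V(D)`: `d⁻(X) ≥ |{ i : Rᵢ ∩ X = ∅ }|`. -/
theorem edmonds_branchings
    {V A : Type} [Fintype V] [DecidableEq V] [Fintype A] [DecidableEq A]
    (tl hd : A → V) (hloop : ∀ a, tl a ≠ hd a)
    (k : ℕ) (R : Fin k → Finset V) (hR : ∀ i, (R i).Nonempty) :
    (∃ B : Fin k → Finset A,
        (∀ i, IsBranching tl hd (B i)) ∧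
        (∀ i j, i ≠ j → Disjoint (B i) (B j)) ∧
        (∀ i, roots hd (B i) = R i)) ↔
    (∀ X : Finset V, X.Nonempty →
        (Finset.univ.filter fun i : Fin k => ∀ v ∈ X, v ∉ R i).card
          ≤ dInD tl hd Finset.univ X) := by
  constructor
  · rintro ⟨B, hB, hdisj, hroots⟩ X hX
    exact avoidCount_le_dInD tl hd R B hB hdisj hroots X hX
  · intro h
    obtain ⟨B, -, hB⟩ := exists_branchings_of_cut tl hd hloop _ Finset.univ R hR rfl h
    exact ⟨B, hB⟩
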